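/- arXiv:1812.10156 — 7 statements merged into one kernel-verified Lean document; each statement's English description precedes it below -/
import Mathlib

section
/- Let a > 0, z > 0, and let F : [-1,1] → ℝ satisfy: F(1) = 1; -1 < F(t) < 1 for all t ∈ [-1,1); there is a constant F'(1) with 0 < F'(1) and constants C > 0, δ > 0 such that |F(t) - 1 + F'(1)·(1-t)| ≤ C·(1-t)^{3/2} for all t ∈ [1-δ, 1]. For n ≥ 2 set h_n = ⌊a·√(n/ln n)⌋ and N_n(a,z) = binom(n, h_n) · Φ( -F(1 - 2h_n/n)·z / √(1 - F(1 - 2h_n/n)²) ). Then N_n(a,z) → 0 as n → ∞ whenever a < z/(2√(F'(1))), and N_n(a,z) → ∞ as n → ∞ whenever a ≥ z/(2√(F'(1))). -/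
open Real MeasureTheory Filter

/-- The standard normal cumulative distribution function. -/
noncomputable def Phi (t : ℝ) : ℝ := ∫ s in Set.Iic t, Real.exp (-s ^ 2 / 2) / Real.sqrt (2 * Real.pi)

lemma Phi_eq_setIntegral_gaussianPDFReal (t : ℝ) :
    Phi t = ∫ s in Set.Iic t, ProbabilityTheory.gaussianPDFReal 0 1 s := by
  unfold Phi
  congr 1
  ext s
  simp [ProbabilityTheory.gaussianPDFReal, div_eq_inv_mul]

lemma Phi_nonneg (t : ℝ) : 0 ≤ Phi t :=
  integral_nonneg fun s => by positivity

lemma Phi_neg_le {x : ℝ} (hx : 0 ≤ x) : Phi (-x) ≤ exp (-x ^ 2 / 2) := by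
  rw [Phi_eq_setIntegral_gaussianPDFReal]
  calc ∫ s in Set.Iic (-x), ProbabilityTheory.gaussianPDFReal 0 1 s
      ≤ ∫ s in Set.Iic (-x), exp (-x ^ 2 / 2) * ProbabilityTheory.gaussianPDFReal (-x) 1 s := by
        apply setIntegral_mono_on
          (ProbabilityTheory.integrable_gaussianPDFReal 0 1).integrableOn
          ((ProbabilityTheory.integrable_gaussianPDFReal (-x) 1).const_mul _).integrableOn
          measurableSet_Iic
        intro s hs
        rw [Set.mem_Iic] at hs
        simp only [ProbabilityTheory.gaussianPDFReal]
        rw [mul_left_comm, ← exp_add]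
        gcongr
        simp only [NNReal.coe_one]
        nlinarith [mul_nonneg hx (show 0 ≤ -x - s by linarith)]
    _ ≤ ∫ s, exp (-x ^ 2 / 2) * ProbabilityTheory.gaussianPDFReal (-x) 1 s := by
        apply setIntegral_le_integral
          ((ProbabilityTheory.integrable_gaussianPDFReal (-x) 1).const_mul _)
        exact Eventually.of_forall fun s =>
          mul_nonneg (exp_pos _).le (ProbabilityTheory.gaussianPDFReal_nonneg _ _ _)
    _ = exp (-x ^ 2 / 2) := by
        rw [integral_const_mul, ProbabilityTheory.integral_gaussianPDFReal_eq_one _ one_ne_zero,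
          mul_one]

lemma le_Phi_neg {x : ℝ} (hx : 0 ≤ x) : exp (-(x + 1) ^ 2 / 2) / √(2 * π) ≤ Phi (-x) := by
  have hint := ProbabilityTheory.integrable_gaussianPDFReal 0 1
  rw [Phi_eq_setIntegral_gaussianPDFReal]
  calc exp (-(x + 1) ^ 2 / 2) / √(2 * π)
      = exp (-(x + 1) ^ 2 / 2) / √(2 * π) * volume.real (Set.Ioc (-x - 1) (-x)) := by
        rw [Real.volume_real_Ioc_of_le (by linarith)]; ring
    _ ≤ ∫ s in Set.Ioc (-x - 1) (-x), ProbabilityTheory.gaussianPDFReal 0 1 s := by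
        apply setIntegral_ge_of_const_le_real measurableSet_Ioc (by simp) _ hint.integrableOn
        intro s hs
        simp only [ProbabilityTheory.gaussianPDFReal, NNReal.coe_one, mul_one, sub_zero]
        rw [div_eq_inv_mul]
        refine mul_le_mul_of_nonneg_left (exp_le_exp.2 ?_) (by positivity)
        have h1 := hs.1
        have h2 := hs.2
        nlinarith
    _ ≤ _ :=
        setIntegral_mono_set hint.integrableOn
          (.of_forall fun s => ProbabilityTheory.gaussianPDFReal_nonneg _ _ _)
          Set.Ioc_subset_Iic_self.eventuallyLE

lemma div_pow_le_choose (n k : ℕ) (hk : k ≤ n) : ((n : ℝ) / k) ^ k ≤ n.choose k := by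
  induction k generalizing n with
  | zero => simp
  | succ k ih =>
    obtain ⟨m, rfl⟩ : ∃ m, n = m + 1 := ⟨n - 1, by omega⟩
    have hkm : k ≤ m := by omega
    have h1 : ((m.choose k : ℕ) : ℝ) * (m + 1) = ((m + 1).choose (k + 1) : ℕ) * (k + 1) := by
      have := Nat.add_one_mul_choose_eq m k
      rw [mul_comm ((m.choose k : ℕ) : ℝ)]
      exact_mod_cast this
    have h2 : (((m + 1 : ℕ) : ℝ) / (k + 1 : ℕ)) ^ k ≤ m.choose k := by
      rcases Nat.eq_zero_or_pos k with rfl | hk0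
      · simp
      · refine le_trans ?_ (ih m hkm)
        have hk0' : (0 : ℝ) < k := by exact_mod_cast hk0
        have hkm' : (k : ℝ) ≤ m := by exact_mod_cast hkm
        gcongr ?_ ^ _
        push_cast
        rw [div_le_div_iff₀ (by positivity) hk0']
        nlinarith
    have h3 : (((m + 1).choose (k + 1) : ℕ) : ℝ) = m.choose k * ((m + 1 : ℕ) / (k + 1 : ℕ)) := by
      push_cast
      field_simp
      linarith
    rw [h3, pow_succ]
    gcongr

lemma exp_mul_log_le_choose {n k : ℕ} (hk0 : 0 < k) (hk : k ≤ n) :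
    exp (k * (log n - log k)) ≤ n.choose k := by
  have hk0' : (0 : ℝ) < k := by exact_mod_cast hk0
  have hn0 : (0 : ℝ) < n := by exact_mod_cast hk0.trans_le hk
  refine le_trans (le_of_eq ?_) (div_pow_le_choose n k hk)
  rw [← log_div hn0.ne' hk0'.ne', exp_nat_mul, exp_log (by positivity)]

lemma choose_le_exp_mul_log {n k : ℕ} (hk0 : 0 < k) (hn : 0 < n) :
    (n.choose k : ℝ) ≤ exp (k * (log n - log k + 1)) := by
  have hk0' : (0 : ℝ) < k := by exact_mod_cast hk0
  have hn0 : (0 : ℝ) < n := by exact_mod_cast hn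
  calc (n.choose k : ℝ) ≤ (n : ℝ) ^ k / k.factorial := Nat.choose_le_pow_div k n
    _ = (n / k : ℝ) ^ k * ((k : ℝ) ^ k / k.factorial) := by
        rw [div_pow]
        field_simp
    _ ≤ (n / k : ℝ) ^ k * exp k := by
        gcongr
        exact pow_div_factorial_le_exp _ hk0'.le _
    _ = exp (k * (log n - log k + 1)) := by
        rw [mul_add, exp_add, ← log_div hn0.ne' hk0'.ne', exp_nat_mul, exp_log (by positivity),
          mul_one]

lemma sq_div_one_sub_sq_expansion {F : ℝ → ℝ} {D C δ : ℝ} (hD : 0 < D) (hC : 0 < C) (hδ : 0 < δ)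
    (hTaylor : ∀ t ∈ Set.Icc (1 - δ) 1,
      |F t - 1 + D * (1 - t)| ≤ C * (1 - t) ^ ((3 : ℝ) / 2)) :
    ∃ K : ℝ, ∃ d₀ > 0, ∀ d, 0 < d → d < d₀ → 0 ≤ F (1 - d) ∧ F (1 - d) < 1 ∧
      |F (1 - d) ^ 2 / (1 - F (1 - d) ^ 2) - 1 / (2 * D * d)| ≤ K / √d := by
  refine ⟨C / D ^ 2 + 1, min (min δ 1) (min ((D / (2 * C)) ^ 2) (1 / (2 * D))), by positivity, ?_⟩
  intro d hd hd0
  simp only [lt_min_iff] at hd0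
  obtain ⟨⟨hd1, hd2⟩, hd3, hd4⟩ := hd0
  have hT := hTaylor (1 - d) ⟨by linarith, by linarith⟩
  rw [sub_sub_cancel] at hT
  have hs0 : 0 < √d := sqrt_pos.2 hd
  have hsq : √d * √d = d := mul_self_sqrt hd.le
  have h32 : d ^ ((3 : ℝ) / 2) = d * √d := by
    rw [sqrt_eq_rpow, ← rpow_one_add' hd.le (by norm_num)]
    norm_num
  rw [h32] at hT
  set u := √d with hu
  have hu1 : u < 1 := by nlinarith
  have hCu : C * u < D / 2 := by
    have : u < D / (2 * C) := by
      rw [hu, sqrt_lt' (by positivity)]; exact hd3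
    rw [lt_div_iff₀ (by positivity)] at this
    linarith
  obtain ⟨e, he⟩ : ∃ e, F (1 - d) = 1 - e := ⟨1 - F (1 - d), by ring⟩
  rw [he] at hT ⊢
  have hT' := abs_le.1 hT
  have hCdu : C * (d * u) ≤ D / 2 * d := by nlinarith
  have he1 : D * d / 2 ≤ e := by linarith [hT'.2]
  have hDd : d * D < 1 / 2 := by
    rw [lt_div_iff₀ (by positivity)] at hd4; linarith
  have he2 : e ≤ 1 := by linarith [hT'.1]
  have he0 : 0 < e := lt_of_lt_of_le (by positivity) he1
  refine ⟨by linarith, by linarith, ?_⟩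
  have hdecomp : (1 - e) ^ 2 / (1 - (1 - e) ^ 2) - 1 / (2 * D * d) =
      (D * d - e) / (2 * e * (D * d)) + (1 / (2 * (2 - e)) - 1) := by
    have h2e : 2 - e ≠ 0 := by linarith
    have : 1 - (1 - e) ^ 2 = e * (2 - e) := by ring
    rw [this]
    field_simp
    ring
  rw [hdecomp, add_div]
  refine (abs_add_le _ _).trans (add_le_add ?_ ?_)
  · rw [abs_div, abs_of_pos (show 0 < 2 * e * (D * d) by positivity)]
    have hab : |D * d - e| ≤ C * (d * u) := by
      convert hT using 2; ring
    calc |D * d - e| / (2 * e * (D * d)) ≤ C * (d * u) / (2 * (D * d / 2) * (D * d)) := by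
          gcongr
      _ = C / D ^ 2 / u := by
          rw [← hsq]; field_simp
  · have h1 : 1 ≤ 1 / u := by rw [le_div_iff₀ hs0]; linarith
    have h2 : 0 ≤ 1 / (2 * (2 - e)) := by
      have : 0 < 2 - e := by linarith
      positivity
    have h3 : 1 / (2 * (2 - e)) ≤ 1 := by
      rw [div_le_one (by linarith)]; linarith
    rw [abs_le]
    constructor <;> linarith

lemma tendsto_log_natCast_atTop : Tendsto (fun n : ℕ => log n) atTop atTop :=
  tendsto_log_atTop.comp tendsto_natCast_atTop_atTop

lemma tendsto_sqrt_div_log_atTop : Tendsto (fun n : ℕ => √(n / log n)) atTop atTop := by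
  have h0 : Tendsto (fun n : ℕ => log n / n) atTop (nhds 0) := by
    simpa [Function.comp_def] using
      (tendsto_pow_log_div_mul_add_atTop 1 0 1 one_ne_zero).comp tendsto_natCast_atTop_atTop
  have h1 : Tendsto (fun n : ℕ => (log n / n)⁻¹) atTop atTop := by
    apply Tendsto.inv_tendsto_nhdsGT_zero
    rw [tendsto_nhdsWithin_iff]
    refine ⟨h0, ?_⟩
    filter_upwards [tendsto_log_natCast_atTop.eventually_gt_atTop 0, eventually_gt_atTop 0]
      with n hn hn0
    have : (0 : ℝ) < n := by exact_mod_cast hn0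
    exact div_pos hn this
  simp only [inv_div] at h1
  exact tendsto_sqrt_atTop.comp h1

lemma tendsto_log_div_sqrt_div_log :
    Tendsto (fun n : ℕ => log n / √(n / log n)) atTop (nhds 0) := by
  have h0 : Tendsto (fun n : ℕ => log n ^ 3 / n) atTop (nhds 0) := by
    simpa [Function.comp_def] using
      (tendsto_pow_log_div_mul_add_atTop 1 0 3 one_ne_zero).comp tendsto_natCast_atTop_atTop
  have h1 := h0.sqrt
  rw [sqrt_zero] at h1
  refine h1.congr' ?_
  filter_upwards [tendsto_log_natCast_atTop.eventually_gt_atTop 0, eventually_gt_atTop 0]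
    with n hn hn0
  have : (0 : ℝ) < n := by exact_mod_cast hn0
  rw [← sqrt_sq (div_nonneg hn.le (sqrt_nonneg _)), div_pow, sq_sqrt (by positivity)]
  congr 1
  field_simp

lemma tendsto_log_log_div_log :
    Tendsto (fun n : ℕ => log (log n) / log n) atTop (nhds 0) := by
  simpa [Function.comp_def] using
    (tendsto_pow_log_div_mul_add_atTop 1 0 1 one_ne_zero).comp tendsto_log_natCast_atTop

lemma tendsto_floor_div_sqrt {a : ℝ} (ha : 0 < a) :
    Tendsto (fun n : ℕ => (⌊a * √(n / log n)⌋₊ : ℝ) / √(n / log n)) atTop (nhds a) :=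
  (tendsto_nat_floor_mul_div_atTop ha.le).comp tendsto_sqrt_div_log_atTop

lemma tendsto_floor_mul_sqrt_div_log_atTop {a : ℝ} (ha : 0 < a) :
    Tendsto (fun n : ℕ => ⌊a * √(n / log n)⌋₊) atTop atTop :=
  tendsto_nat_floor_atTop.comp (tendsto_sqrt_div_log_atTop.const_mul_atTop ha)

lemma tendsto_log_div_floor {a : ℝ} (ha : 0 < a) :
    Tendsto (fun n : ℕ => log n / (⌊a * √(n / log n)⌋₊ : ℝ)) atTop (nhds 0) := by
  have h := tendsto_log_div_sqrt_div_log.div (tendsto_floor_div_sqrt ha) ha.ne'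
  rw [zero_div] at h
  refine h.congr' ?_
  filter_upwards [tendsto_sqrt_div_log_atTop.eventually_gt_atTop 0] with n hn
  simp only [Pi.div_apply]
  exact div_div_div_cancel_right₀ hn.ne' _ _

lemma natCast_eq_sq_mul_log {n : ℕ} (hw : 0 < √(n / log n)) (hL : 0 < log n) :
    (n : ℝ) = √(n / log n) ^ 2 * log n := by
  rw [sq_sqrt (sqrt_pos.1 hw).le, div_mul_cancel₀ _ hL.ne']

lemma tendsto_floor_div_natCast {a : ℝ} (ha : 0 < a) :
    Tendsto (fun n : ℕ => 2 * (⌊a * √(n / log n)⌋₊ : ℝ) / n) atTop (nhds 0) := by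
  have h := ((tendsto_floor_div_sqrt ha).const_mul 2).mul
    (tendsto_inv_atTop_zero.comp
      (tendsto_sqrt_div_log_atTop.atTop_mul_atTop₀ tendsto_log_natCast_atTop))
  rw [mul_zero] at h
  refine h.congr' ?_
  filter_upwards [tendsto_sqrt_div_log_atTop.eventually_gt_atTop 0,
    tendsto_log_natCast_atTop.eventually_gt_atTop 0] with n hw hL
  have hn := natCast_eq_sq_mul_log hw hL
  simp only [Function.comp_apply]
  generalize √(n / log n) = w at *
  generalize (⌊a * w⌋₊ : ℝ) = h
  generalize log n = L at *
  rw [hn]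
  field_simp

lemma log_sqrt_div_log {n : ℕ} (hn : 0 < n) (hL : 0 < log n) :
    log √(n / log n) = log n / 2 - log (log n) / 2 := by
  have hn0 : (0 : ℝ) < n := by exact_mod_cast hn
  rw [log_sqrt (by positivity), log_div hn0.ne' hL.ne']
  ring

lemma tendsto_odds_div_sqrt_sub {a : ℝ} (ha : 0 < a) {D : ℝ} (hD : 0 < D) {G : ℝ → ℝ} {K d₀ : ℝ}
    (hd₀ : 0 < d₀) (hG : ∀ d, 0 < d → d < d₀ → |G d - 1 / (2 * D * d)| ≤ K / √d) :
    Tendsto (fun n : ℕ => G (2 * (⌊a * √(n / log n)⌋₊ : ℝ) / n) / √(n / log n) -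
      log n / (4 * D * a)) atTop (nhds 0) := by
  have hlim := ((((tendsto_log_div_floor ha).div_const 2).sqrt).const_mul K).add
    ((tendsto_log_div_floor ha).mul_const (1 / (4 * D * a)))
  simp only [zero_div, sqrt_zero, mul_zero, zero_mul, add_zero] at hlim
  refine squeeze_zero_norm' ?_ hlim
  filter_upwards [tendsto_sqrt_div_log_atTop.eventually_gt_atTop 0,
    tendsto_log_natCast_atTop.eventually_gt_atTop 0,
    (tendsto_floor_mul_sqrt_div_log_atTop ha).eventually_gt_atTop 0,
    (tendsto_floor_div_natCast ha).eventually_lt_const hd₀, eventually_gt_atTop 0]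
    with n hw hL hh hd hn0
  have hn := natCast_eq_sq_mul_log hw hL
  have hh1 : (⌊a * √(n / log n)⌋₊ : ℝ) ≤ a * √(n / log n) := Nat.floor_le (by positivity)
  have hh2 := Nat.lt_floor_add_one (a * √(n / log n))
  have hh0 : (0 : ℝ) < ⌊a * √(n / log n)⌋₊ := by exact_mod_cast hh
  have hn0' : (0 : ℝ) < n := by exact_mod_cast hn0
  generalize √(n / log n) = w at *
  generalize (⌊a * w⌋₊ : ℝ) = h at *
  generalize log n = L at *
  generalize (n : ℝ) = m at *
  have hd0 : 0 < 2 * h / m := by positivity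
  have hGd := hG _ hd0 hd
  have hsplit : G (2 * h / m) / w - L / (4 * D * a) =
      (G (2 * h / m) - 1 / (2 * D * (2 * h / m))) / w + L * (a * w - h) / (h * (4 * D * a)) := by
    rw [hn]
    field_simp
    ring
  rw [hsplit, norm_eq_abs]
  refine (abs_add_le _ _).trans (add_le_add ?_ ?_)
  · rw [abs_div, abs_of_pos hw]
    refine (div_le_div_of_nonneg_right hGd hw.le).trans (le_of_eq ?_)
    have h1 : √(2 * h / m) * w = √(2 * h / L) := by
      conv_lhs => rw [← sqrt_sq hw.le]
      rw [← sqrt_mul hd0.le, hn]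
      congr 1
      field_simp
    have h2 : L / h / 2 = (2 * h / L)⁻¹ := by field_simp
    rw [div_div, h1, h2, sqrt_inv, div_eq_mul_inv]
  · rw [abs_of_nonneg (by have : 0 ≤ a * w - h := by linarith
                          positivity), div_mul_div_comm]
    gcongr
    linarith

lemma tendsto_log_sub_log_floor_div_log {a : ℝ} (ha : 0 < a) :
    Tendsto (fun n : ℕ => (log n - log (⌊a * √(n / log n)⌋₊ : ℝ) + 1) / log n) atTop
      (nhds (1 / 2)) := by
  have hlim := (((tendsto_log_log_div_log.div_const 2).const_add (1 / 2)).sub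
    (((tendsto_floor_div_sqrt ha).log ha.ne').mul
      (tendsto_inv_atTop_zero.comp tendsto_log_natCast_atTop))).add
    (tendsto_inv_atTop_zero.comp tendsto_log_natCast_atTop)
  simp only [zero_div, mul_zero, sub_zero, add_zero] at hlim
  refine hlim.congr' ?_
  filter_upwards [tendsto_sqrt_div_log_atTop.eventually_gt_atTop 0,
    tendsto_log_natCast_atTop.eventually_gt_atTop 0,
    (tendsto_floor_mul_sqrt_div_log_atTop ha).eventually_gt_atTop 0, eventually_gt_atTop 0]
    with n hw hL hh hn0
  have hh0 : (0 : ℝ) < ⌊a * √(n / log n)⌋₊ := by exact_mod_cast hh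
  rw [log_div hh0.ne' hw.ne', log_sqrt_div_log hn0 hL]
  simp only [Function.comp_apply]
  field_simp
  ring

lemma tendsto_exponent_atBot {a c : ℝ} (ha : 0 < a) (hac : a < c / a) {q : ℕ → ℝ}
    (hq : Tendsto (fun n : ℕ => q n / √(n / log n) - c / a * log n) atTop (nhds 0)) :
    Tendsto (fun n : ℕ => (⌊a * √(n / log n)⌋₊ : ℝ) *
      (log n - log (⌊a * √(n / log n)⌋₊ : ℝ) + 1) - q n / 2) atTop atBot := by
  have hlim := ((tendsto_floor_div_sqrt ha).mul (tendsto_log_sub_log_floor_div_log ha)).sub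
    (((hq.mul (tendsto_inv_atTop_zero.comp tendsto_log_natCast_atTop)).add_const
      (c / a)).div_const 2)
  have hneg : a * (1 / 2) - (0 * 0 + c / a) / 2 < 0 := by linarith
  refine ((tendsto_sqrt_div_log_atTop.atTop_mul_atTop₀ tendsto_log_natCast_atTop).atTop_mul_neg
    hneg hlim).congr' ?_
  filter_upwards [tendsto_sqrt_div_log_atTop.eventually_gt_atTop 0,
    tendsto_log_natCast_atTop.eventually_gt_atTop 0] with n hw hL
  simp only [Function.comp_apply]
  generalize √(n / log n) = w at *
  generalize (⌊a * w⌋₊ : ℝ) = h at *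
  generalize log h = l
  generalize log n = L at *
  field_simp
  ring

lemma tendsto_exponent_atTop {a c : ℝ} (ha : 0 < a) (hac : c / a ≤ a) {x : ℕ → ℝ}
    (hx : ∀ᶠ n in atTop, 0 ≤ x n)
    (hq : Tendsto (fun n : ℕ => x n ^ 2 / √(n / log n) - c / a * log n) atTop (nhds 0)) :
    Tendsto (fun n : ℕ => (⌊a * √(n / log n)⌋₊ : ℝ) *
      (log n - log (⌊a * √(n / log n)⌋₊ : ℝ)) - (x n + 1) ^ 2 / 2) atTop atTop := by
  have hwinv := tendsto_inv_atTop_zero.comp tendsto_sqrt_div_log_atTop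
  have hLw := tendsto_log_div_sqrt_div_log
  have hloglog : Tendsto (fun n : ℕ => log (log n)) atTop atTop :=
    tendsto_log_atTop.comp tendsto_log_natCast_atTop
  have hlogw : Tendsto (fun n : ℕ => log (log n) / √(n / log n)) atTop (nhds 0) := by
    have h := tendsto_log_log_div_log.mul hLw
    rw [mul_zero] at h
    refine h.congr' ?_
    filter_upwards [tendsto_log_natCast_atTop.eventually_gt_atTop 0] with n hL
    rw [div_mul_div_cancel₀ hL.ne']
  have hxw : Tendsto (fun n : ℕ => x n / √(n / log n)) atTop (nhds 0) := by
    have h := ((hq.mul hwinv).add (hLw.const_mul (c / a))).sqrt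
    simp only [mul_zero, add_zero, sqrt_zero] at h
    refine h.congr' ?_
    filter_upwards [tendsto_sqrt_div_log_atTop.eventually_gt_atTop 0, hx] with n hw hxn
    rw [← sqrt_sq (div_nonneg hxn hw.le)]
    congr 1
    simp only [Function.comp_apply]
    field_simp
    ring
  have herr := (((hLw.div_const 2).add (hlogw.div_const 2)).sub (hwinv.const_mul (log a))).add
    (((hq.div_const 2).add hxw).add (hwinv.div_const 2)) |>.add_const (a * log a) |>.neg
  have hbr := tendsto_sqrt_div_log_atTop.atTop_mul_atTop₀
    ((hloglog.const_mul_atTop (half_pos ha)).atTop_add herr)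
  refine tendsto_atTop_mono' _ ?_ hbr
  filter_upwards [tendsto_sqrt_div_log_atTop.eventually_gt_atTop 0,
    tendsto_log_natCast_atTop.eventually_gt_atTop 0,
    (tendsto_floor_mul_sqrt_div_log_atTop ha).eventually_gt_atTop 0, eventually_gt_atTop 0,
    hloglog.eventually_ge_atTop (2 * log a)] with n hw hL hh hn0 hll
  have hh1 : (⌊a * √(n / log n)⌋₊ : ℝ) ≤ a * √(n / log n) := Nat.floor_le (by positivity)
  have hh2 := Nat.lt_floor_add_one (a * √(n / log n))
  have hh0 : (0 : ℝ) < ⌊a * √(n / log n)⌋₊ := by exact_mod_cast hh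
  have hlogh := log_le_log hh0 hh1
  rw [log_mul ha.ne' hw.ne', log_sqrt_div_log hn0 hL] at hlogh
  simp only [Function.comp_apply]
  generalize √(n / log n) = w at *
  generalize (⌊a * w⌋₊ : ℝ) = h at *
  generalize log h = l at *
  generalize log (log n) = M at *
  generalize log n = L at *
  have hN : 0 ≤ L / 2 + M / 2 - log a := by linarith
  have hprod : (a * w - 1) * (L / 2 + M / 2 - log a) ≤ h * (L - l) :=
    calc (a * w - 1) * (L / 2 + M / 2 - log a) ≤ h * (L / 2 + M / 2 - log a) := by
          gcongr; linarith
      _ ≤ h * (L - l) := mul_le_mul_of_nonneg_left (by linarith) hh0.le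
  have hcrit : c / a * (w * L) ≤ a * (w * L) := by gcongr
  have hexp : ∀ k : ℝ, w * (a / 2 * M + -(L / w / 2 + M / w / 2 - log a * w⁻¹ +
      ((x n ^ 2 / w - k * L) / 2 + x n / w + w⁻¹ / 2) + a * log a)) =
      (a * w - 1) * (L / 2 + M / 2 - log a) - (x n + 1) ^ 2 / 2 +
        (k * (w * L) - a * (w * L)) / 2 := by
    intro k
    field_simp
    ring
  rw [hexp]
  linarith

/-- The expected number `N_n(a,z) = C(n, h_n) · Φ(-F(1-2h_n/n)z/√(1-F(1-2h_n/n)²))`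
(with `h_n = ⌊a√(n/ln n)⌋`) of bit strings at Hamming distance `h_n` from a fixed input
with a different classification tends to `0` when `a < z/(2√F'(1))` and to `∞` when
`a ≥ z/(2√F'(1))`. -/
theorem expected_number_limit (a z : ℝ) (ha : 0 < a) (hz : 0 < z)
    (F : ℝ → ℝ) (hF1 : F 1 = 1)
    (hFrange : ∀ t ∈ Set.Ico (-1 : ℝ) 1, -1 < F t ∧ F t < 1)
    (D : ℝ) (hD : 0 < D) (C δ : ℝ) (hC : 0 < C) (hδ : 0 < δ)
    (hTaylor : ∀ t ∈ Set.Icc (1 - δ) 1, |F t - 1 + D * (1 - t)| ≤ C * (1 - t) ^ ((3 : ℝ) / 2)) :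
    (a < z / (2 * Real.sqrt D) →
      Tendsto (fun n : ℕ => (n.choose ⌊a * Real.sqrt (n / Real.log n)⌋₊ : ℝ) *
          Phi (-(F (1 - 2 * (⌊a * Real.sqrt (n / Real.log n)⌋₊ : ℝ) / n) * z) /
            Real.sqrt (1 - (F (1 - 2 * (⌊a * Real.sqrt (n / Real.log n)⌋₊ : ℝ) / n)) ^ 2)))
        atTop (nhds 0)) ∧
    (z / (2 * Real.sqrt D) ≤ a →
      Tendsto (fun n : ℕ => (n.choose ⌊a * Real.sqrt (n / Real.log n)⌋₊ : ℝ) *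
          Phi (-(F (1 - 2 * (⌊a * Real.sqrt (n / Real.log n)⌋₊ : ℝ) / n) * z) /
            Real.sqrt (1 - (F (1 - 2 * (⌊a * Real.sqrt (n / Real.log n)⌋₊ : ℝ) / n)) ^ 2)))
        atTop atTop) := by
  obtain ⟨K, d₀, hd₀, hF⟩ := sq_div_one_sub_sq_expansion hD hC hδ hTaylor
  have hq := (tendsto_odds_div_sqrt_sub ha hD hd₀ fun d h0 h1 => (hF d h0 h1).2.2).const_mul (z ^ 2)
  rw [mul_zero] at hq
  set x : ℕ → ℝ := fun n => F (1 - 2 * (⌊a * √(n / log n)⌋₊ : ℝ) / n) * z /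
    √(1 - (F (1 - 2 * (⌊a * √(n / log n)⌋₊ : ℝ) / n)) ^ 2) with hxdef
  have hev : ∀ᶠ n : ℕ in atTop, 0 < n ∧ 0 < ⌊a * √(n / log n)⌋₊ ∧ ⌊a * √(n / log n)⌋₊ ≤ n ∧
      0 ≤ F (1 - 2 * (⌊a * √(n / log n)⌋₊ : ℝ) / n) ∧
      F (1 - 2 * (⌊a * √(n / log n)⌋₊ : ℝ) / n) < 1 := by
    filter_upwards [(tendsto_floor_mul_sqrt_div_log_atTop ha).eventually_gt_atTop 0,
      (tendsto_floor_div_natCast ha).eventually_lt_const hd₀,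
      (tendsto_floor_div_natCast ha).eventually_lt_const one_pos, eventually_gt_atTop 0]
      with n hh hd hd1 hn
    have hn' : (0 : ℝ) < n := by exact_mod_cast hn
    have hh' : (0 : ℝ) < ⌊a * √(n / log n)⌋₊ := by exact_mod_cast hh
    obtain ⟨h1, h2, -⟩ := hF _ (by positivity) hd
    refine ⟨hn, hh, ?_, h1, h2⟩
    rw [div_lt_one hn'] at hd1
    have : (⌊a * √(n / log n)⌋₊ : ℝ) ≤ n := by linarith
    exact_mod_cast this
  have hx0 : ∀ᶠ n in atTop, 0 ≤ x n := by
    filter_upwards [hev] with n hn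
    have := hn.2.2.2.1
    positivity
  have hx2 : Tendsto (fun n : ℕ => x n ^ 2 / √(n / log n) - z ^ 2 / (4 * D) / a * log n) atTop
      (nhds 0) := by
    refine hq.congr' ?_
    filter_upwards [hev] with n hn
    obtain ⟨-, -, -, h1, h2⟩ := hn
    simp only [hxdef]
    rw [div_pow, sq_sqrt (by nlinarith)]
    ring
  have hcrit : z ^ 2 / (4 * D) = (z / (2 * √D)) ^ 2 := by
    rw [div_pow, mul_pow, sq_sqrt hD.le]; norm_num
  simp_rw [neg_div]
  constructor
  · intro haz
    have hac : a < z ^ 2 / (4 * D) / a := by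
      rw [lt_div_iff₀ ha, hcrit, ← sq]
      gcongr
    have hlim := tendsto_exp_atBot.comp (tendsto_exponent_atBot ha hac hx2)
    refine squeeze_zero' (Eventually.of_forall fun n => mul_nonneg (Nat.cast_nonneg _)
      (Phi_nonneg _)) ?_ hlim
    filter_upwards [hev, hx0] with n hn hxn
    rw [Function.comp_apply, sub_eq_add_neg (_ * _ : ℝ), exp_add, ← neg_div (2 : ℝ)]
    exact mul_le_mul (choose_le_exp_mul_log hn.2.1 hn.1) (Phi_neg_le hxn) (Phi_nonneg _)
      (exp_pos _).le
  · intro haz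
    have hac : z ^ 2 / (4 * D) / a ≤ a := by
      rw [div_le_iff₀ ha, hcrit, ← sq]
      gcongr
    have hlim := (tendsto_exp_atTop.comp (tendsto_exponent_atTop ha hac hx0 hx2)).atTop_div_const
      (show 0 < √(2 * π) by positivity)
    refine tendsto_atTop_mono' _ ?_ hlim
    filter_upwards [hev, hx0] with n hn hxn
    rw [Function.comp_apply, sub_eq_add_neg (_ * _ : ℝ), exp_add, ← neg_div (2 : ℝ), mul_div_assoc]
    exact mul_le_mul (exp_mul_log_le_choose hn.2.1 hn.2.2.1) (le_Phi_neg hxn) (by positivity)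
      (Nat.cast_nonneg _)
end

section
/- Let σ_w > 0 and σ_b ≥ 0. Define Q_1 = σ_w² + σ_b² and Q_l = σ_w²·Q_{l-1}/2 + σ_b² for l ≥ 2. Define F_1(t) = (σ_w²·t + σ_b²)/(σ_w² + σ_b²) and, for l ≥ 2 and t ∈ [-1,1], F_l(t) = (Q_{l-1}·σ_w²·Ψ(F_{l-1}(t)) + 2σ_b²)/(Q_{l-1}·σ_w² + 2σ_b²), where Ψ(t) = (√(1-t²) + (π - arccos t)·t)/π. Then for every l ≥ 1 and every t ∈ [-1,1], t ≤ F_l(t) ≤ 1. -/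
open Real

/-- The normalized arc-cosine kernel function arising from the ReLU activation. -/
noncomputable def Psi (t : ℝ) : ℝ :=
  (Real.sqrt (1 - t ^ 2) + (Real.pi - Real.arccos t) * t) / Real.pi

theorem le_Psi (t : ℝ) : t ≤ Psi t := by
  have key : arccos t * t ≤ √(1 - t ^ 2) := by
    rcases le_or_gt t 0 with h | h
    · exact (mul_nonpos_of_nonneg_of_nonpos (arccos_nonneg t) h).trans (sqrt_nonneg _)
    · have := le_tan (arccos_nonneg t) (arccos_lt_pi_div_two.2 h)
      rwa [tan_arccos, le_div_iff₀ h] at this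
  rw [Psi, le_div_iff₀ pi_pos]
  linarith

theorem Psi_le_one {t : ℝ} (ht : t ≤ 1) : Psi t ≤ 1 := by
  have hsin : √(1 - t ^ 2) ≤ arccos t := sin_arccos t ▸ sin_le (arccos_nonneg t)
  have hmul : (π - arccos t) * t ≤ π - arccos t :=
    mul_le_of_le_one_right (sub_nonneg.2 (arccos_le_pi t)) ht
  rw [Psi, div_le_one pi_pos]
  linarith

/-- A weighted average of `x` and `1` lies in `[t, 1]` if `x` does. -/
theorem weighted_average_mem_Icc {a b x t : ℝ} (ha : 0 < a) (hb : 0 ≤ b)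
    (htx : t ≤ x) (hx : x ≤ 1) : t ≤ (a * x + b) / (a + b) ∧ (a * x + b) / (a + b) ≤ 1 := by
  have hab : 0 < a + b := by positivity
  rw [le_div_iff₀ hab, div_le_one hab]
  constructor <;> nlinarith

/-- The layerwise correlation functions `F_l` of a random deep neural network with ReLU
activation satisfy `t ≤ F_l(t) ≤ 1` on `[-1,1]`. -/
theorem correlation_function_bounds (σw σb : ℝ) (hw : 0 < σw) (hb : 0 ≤ σb)
    (Q : ℕ → ℝ) (hQ1 : Q 1 = σw ^ 2 + σb ^ 2)
    (hQl : ∀ l, 2 ≤ l → Q l = σw ^ 2 * Q (l - 1) / 2 + σb ^ 2)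
    (F : ℕ → ℝ → ℝ)
    (hF1 : ∀ t ∈ Set.Icc (-1 : ℝ) 1, F 1 t = (σw ^ 2 * t + σb ^ 2) / (σw ^ 2 + σb ^ 2))
    (hFl : ∀ l, 2 ≤ l → ∀ t ∈ Set.Icc (-1 : ℝ) 1,
      F l t = (Q (l - 1) * σw ^ 2 * Psi (F (l - 1) t) + 2 * σb ^ 2) /
        (Q (l - 1) * σw ^ 2 + 2 * σb ^ 2)) :
    ∀ l, 1 ≤ l → ∀ t ∈ Set.Icc (-1 : ℝ) 1, t ≤ F l t ∧ F l t ≤ 1 := by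
  have hQ : ∀ l, 1 ≤ l → 0 < Q l := by
    intro l hl
    induction l, hl using Nat.le_induction with
    | base => rw [hQ1]; positivity
    | succ n hn ih =>
      rw [hQl (n + 1) (by omega), Nat.add_sub_cancel]
      positivity
  intro l hl t ht
  induction l, hl using Nat.le_induction with
  | base =>
    rw [hF1 t ht]
    exact weighted_average_mem_Icc (by positivity) (by positivity) le_rfl ht.2
  | succ n hn ih =>
    have hQn := hQ n hn
    rw [hFl (n + 1) (by omega) t ht, Nat.add_sub_cancel]
    exact weighted_average_mem_Icc (by positivity) (by positivity)
      (ih.1.trans (le_Psi _)) (Psi_le_one ih.2)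
end

section
/- Let Ψ : [-1,1] → ℝ be defined by Ψ(t) = (√(1-t²) + (π - arccos t)·t)/π. Then there exist constants C > 0 and δ > 0 such that for all t ∈ [1-δ, 1], 0 ≤ Ψ(t) - t ≤ C·(1-t)^{3/2}. -/
open Real

theorem Psi_sub_self (t : ℝ) :
    Psi t - t = (Real.sin (Real.arccos t) - Real.arccos t * t) / Real.pi := by
  have hπ := Real.pi_ne_zero
  rw [Psi, Real.sin_arccos]
  field_simp
  ring

theorem Psi_sub_self_nonneg {t : ℝ} (h0 : 0 < t) (h1 : t ≤ 1) : 0 ≤ Psi t - t := by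
  have htan := Real.le_tan (Real.arccos_nonneg t) (Real.arccos_lt_pi_div_two.2 h0)
  rw [Real.tan_eq_sin_div_cos, Real.cos_arccos (by linarith) h1, le_div_iff₀ h0] at htan
  rw [Psi_sub_self]
  exact div_nonneg (sub_nonneg.2 htan) Real.pi_pos.le

theorem arccos_le_pi_mul_sqrt_one_sub {t : ℝ} (h0 : -1 ≤ t) (h1 : t ≤ 1) :
    Real.arccos t ≤ Real.pi * √(1 - t) := by
  have hcos := Real.cos_le_one_sub_mul_cos_sq
    ((abs_of_nonneg (Real.arccos_nonneg t)).trans_le (Real.arccos_le_pi t))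
  rw [Real.cos_arccos h0 h1, div_mul_eq_mul_div, le_sub_comm,
    div_le_iff₀ (pow_pos Real.pi_pos 2)] at hcos
  refine le_of_sq_le_sq ?_ (by positivity)
  rw [mul_pow, Real.sq_sqrt (sub_nonneg.2 h1)]
  nlinarith [sq_nonneg (Real.arccos t)]

theorem Psi_sub_self_le {t : ℝ} (h0 : -1 ≤ t) (h1 : t ≤ 1) :
    Psi t - t ≤ (1 - t) ^ ((3 : ℝ) / 2) := by
  have hpow : (1 - t) ^ ((3 : ℝ) / 2) = √(1 - t) * (1 - t) := by
    rw [Real.sqrt_eq_rpow, show (3 : ℝ) / 2 = 1 / 2 + 1 by norm_num,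
      Real.rpow_add_one' (sub_nonneg.2 h1) (by norm_num)]
  rw [Psi_sub_self, hpow, div_le_iff₀ Real.pi_pos]
  nlinarith [Real.sin_le (Real.arccos_nonneg t),
    mul_le_mul_of_nonneg_right (arccos_le_pi_mul_sqrt_one_sub h0 h1) (sub_nonneg.2 h1)]

/-- Taylor-type expansion of the arc-cosine kernel function at `t = 1`:
`Ψ(t) = t + O((1-t)^{3/2})` as `t → 1⁻`, with a one-sided bound `0 ≤ Ψ(t) - t`. -/
theorem Psi_taylor_expansion :
    ∃ C > (0 : ℝ), ∃ δ > (0 : ℝ), ∀ t ∈ Set.Icc (1 - δ) (1 : ℝ),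
      0 ≤ Psi t - t ∧ Psi t - t ≤ C * (1 - t) ^ ((3 : ℝ) / 2) := by
  refine ⟨1, one_pos, 1 / 2, by norm_num, fun t ⟨h0, h1⟩ => ⟨?_, ?_⟩⟩
  · exact Psi_sub_self_nonneg (by linarith) h1
  · rw [one_mul]
    exact Psi_sub_self_le (by linarith) h1
end

section
/- Let σ_w > 0 and σ_b ≥ 0. Define Q_1 = σ_w² + σ_b² and Q_l = σ_w²·Q_{l-1}/2 + σ_b² for l ≥ 2. Define F_1(t) = (σ_w²·t + σ_b²)/(σ_w² + σ_b²) and, for l ≥ 2 and t ∈ [-1,1], F_l(t) = (Q_{l-1}·σ_w²·Ψ(F_{l-1}(t)) + 2σ_b²)/(Q_{l-1}·σ_w² + 2σ_b²), where Ψ(t) = (√(1-t²) + (π - arccos t)·t)/π. Define D_1 = σ_w²/(σ_w² + σ_b²) and D_l = (Q_{l-1}·σ_w²/(Q_{l-1}·σ_w² + 2σ_b²))·D_{l-1} for l ≥ 2. Then for every l ≥ 1 there exist constants C > 0 and δ > 0 such that for all t ∈ [1-δ, 1], | F_l(t) - 1 + D_l·(1-t) | ≤ C·(1-t)^{3/2}.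 In particular F_l has left derivative D_l at t = 1. -/
open Real

/-- The kernel `Psi` dominates the identity on `[-1, 1]`. -/
lemma self_le_Psi {u : ℝ} (hu : u ∈ Set.Icc (-1 : ℝ) 1) : u ≤ Psi u := by
  have hc := Real.cos_arccos hu.1 hu.2
  have hθ0 := Real.arccos_nonneg u
  have key : Real.arccos u * u ≤ √(1 - u ^ 2) := by
    rcases le_or_gt u 0 with h | h
    · exact (mul_nonpos_of_nonneg_of_nonpos hθ0 h).trans (Real.sqrt_nonneg _)
    · have ht := Real.le_tan hθ0 (Real.arccos_lt_pi_div_two.2 h)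
      rwa [Real.tan_eq_sin_div_cos, hc, Real.sin_arccos, le_div_iff₀ h] at ht
  rw [Psi, le_div_iff₀ Real.pi_pos]
  linarith

lemma Psi_sub_self_le_s9 (u : ℝ) :
    Psi u - u ≤ Real.arccos u * (1 - u) / Real.pi := by
  have h := Real.sin_le (Real.arccos_nonneg u)
  rw [Real.sin_arccos] at h
  have hpi : Psi u - u = (√(1 - u ^ 2) - Real.arccos u * u) / Real.pi := by
    rw [Psi]
    field_simp
    ring
  rw [hpi]
  gcongr
  linarith

lemma Psi_le_one_s9 {u : ℝ} (hu : u ∈ Set.Icc (-1 : ℝ) 1) : Psi u ≤ 1 := by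
  have h : Real.arccos u * (1 - u) / Real.pi ≤ 1 - u := by
    rw [div_le_iff₀ Real.pi_pos, mul_comm]
    exact mul_le_mul_of_nonneg_left (Real.arccos_le_pi u) (sub_nonneg.2 hu.2)
  linarith [Psi_sub_self_le_s9 u]

lemma arccos_le_pi_mul_sqrt {u : ℝ} (hu : u ∈ Set.Icc (-1 : ℝ) 1) :
    Real.arccos u ≤ Real.pi * √(1 - u) := by
  have hθ0 := Real.arccos_nonneg u
  have h := Real.cos_le_one_sub_mul_cos_sq
    ((abs_of_nonneg hθ0).trans_le (Real.arccos_le_pi u))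
  rw [Real.cos_arccos hu.1 hu.2] at h
  have hs : 0 ≤ 1 - u := sub_nonneg.2 hu.2
  refine abs_le_of_sq_le_sq' ?_ (by positivity) |>.2
  rw [mul_pow, Real.sq_sqrt hs]
  have h2 : 2 / Real.pi ^ 2 * Real.arccos u ^ 2 ≤ 1 - u := by linarith
  rw [div_mul_eq_mul_div, div_le_iff₀ (by positivity)] at h2
  nlinarith [sq_nonneg (Real.arccos u)]

lemma rpow_three_halves {s : ℝ} (hs : 0 ≤ s) : s ^ ((3 : ℝ) / 2) = s * √s := by
  rw [Real.sqrt_eq_rpow, ← Real.rpow_one_add' hs (by norm_num)]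
  norm_num

/-- Near `u = 1` the kernel `Psi` is the identity up to order `3/2`. -/
lemma Psi_sub_self_le_rpow {u : ℝ} (hu : u ∈ Set.Icc (-1 : ℝ) 1) :
    Psi u - u ≤ (1 - u) ^ ((3 : ℝ) / 2) := by
  have hs : 0 ≤ 1 - u := sub_nonneg.2 hu.2
  refine (Psi_sub_self_le_s9 u).trans ?_
  rw [rpow_three_halves hs, div_le_iff₀ Real.pi_pos]
  linarith [mul_le_mul_of_nonneg_right (arccos_le_pi_mul_sqrt hu) hs]

/-- A first-order expansion at `1` from the left with remainder of order `3/2` gives the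
left derivative. -/
lemma hasDerivWithinAt_of_abs_le_rpow {f : ℝ → ℝ} {d C : ℝ}
    (h : ∀ t ∈ Set.Icc (-1 : ℝ) 1, |f t - 1 + d * (1 - t)| ≤ C * (1 - t) ^ ((3 : ℝ) / 2)) :
    HasDerivWithinAt f d (Set.Icc (-1 : ℝ) 1) 1 := by
  have h1 : f 1 = 1 := by
    have := h 1 (by norm_num)
    rw [rpow_three_halves (by norm_num)] at this
    simp only [sub_self, mul_zero, zero_mul, add_zero] at this
    linarith [abs_nonpos_iff.1 this]
  rw [hasDerivWithinAt_iff_tendsto]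
  have hlim : Filter.Tendsto (fun t : ℝ => C * √(1 - t))
      (nhdsWithin 1 (Set.Icc (-1 : ℝ) 1)) (nhds 0) := by
    have hc : Continuous fun t : ℝ => C * √(1 - t) := by fun_prop
    simpa using (hc.tendsto 1).mono_left nhdsWithin_le_nhds
  refine squeeze_zero' (.of_forall fun t => by positivity) ?_ hlim
  filter_upwards [self_mem_nhdsWithin] with t ht
  have hs : 0 ≤ 1 - t := sub_nonneg.2 ht.2
  have hb := h t ht
  rw [rpow_three_halves hs] at hb
  rcases hs.eq_or_lt with h0 | h0
  · have : t = 1 := by linarith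
    simp [this]
  · rw [Real.norm_eq_abs, Real.norm_eq_abs, abs_sub_comm t 1, abs_of_pos h0, h1, smul_eq_mul,
      inv_mul_le_iff₀ h0]
    calc |f t - 1 - (t - 1) * d| = |f t - 1 + d * (1 - t)| := by ring_nf
      _ ≤ C * ((1 - t) * √(1 - t)) := hb
      _ = (1 - t) * (C * √(1 - t)) := by ring

/-- Short-distance correlation expansion of the layerwise correlation functions of a
random deep neural network with ReLU activation:
`F_l(t) = 1 - F_l'(1)(1-t) + O((1-t)^{3/2})` as `t → 1⁻`, where `D_l = F_l'(1)` satisfies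
the stated recursion; in particular `F_l` has left derivative `D_l` at `t = 1`. -/
theorem correlation_function_taylor (σw σb : ℝ) (hw : 0 < σw) (hb : 0 ≤ σb)
    (Q : ℕ → ℝ) (hQ1 : Q 1 = σw ^ 2 + σb ^ 2)
    (hQl : ∀ l, 2 ≤ l → Q l = σw ^ 2 * Q (l - 1) / 2 + σb ^ 2)
    (F : ℕ → ℝ → ℝ)
    (hF1 : ∀ t ∈ Set.Icc (-1 : ℝ) 1, F 1 t = (σw ^ 2 * t + σb ^ 2) / (σw ^ 2 + σb ^ 2))
    (hFl : ∀ l, 2 ≤ l → ∀ t ∈ Set.Icc (-1 : ℝ) 1,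
      F l t = (Q (l - 1) * σw ^ 2 * Psi (F (l - 1) t) + 2 * σb ^ 2) /
        (Q (l - 1) * σw ^ 2 + 2 * σb ^ 2))
    (D : ℕ → ℝ) (hD1 : D 1 = σw ^ 2 / (σw ^ 2 + σb ^ 2))
    (hDl : ∀ l, 2 ≤ l →
      D l = (Q (l - 1) * σw ^ 2 / (Q (l - 1) * σw ^ 2 + 2 * σb ^ 2)) * D (l - 1)) :
    ∀ l, 1 ≤ l →
      (∃ C > (0 : ℝ), ∃ δ > (0 : ℝ), ∀ t ∈ Set.Icc (1 - δ) (1 : ℝ),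
        |F l t - 1 + D l * (1 - t)| ≤ C * (1 - t) ^ ((3 : ℝ) / 2)) ∧
      HasDerivWithinAt (F l) (D l) (Set.Icc (-1 : ℝ) 1) 1 := by
  have hQpos : ∀ l, 1 ≤ l → 0 < Q l := by
    intro l hl
    induction l, hl using Nat.le_induction with
    | base => rw [hQ1]; positivity
    | succ n hn ih =>
      rw [hQl (n + 1) (by omega), Nat.add_sub_cancel]
      positivity
  have key : ∀ l, 1 ≤ l → ∃ C > (0 : ℝ), ∀ t ∈ Set.Icc (-1 : ℝ) 1,
      (t ≤ F l t ∧ F l t ≤ 1) ∧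
      |F l t - 1 + D l * (1 - t)| ≤ C * (1 - t) ^ ((3 : ℝ) / 2) := by
    intro l hl
    induction l, hl using Nat.le_induction with
    | base =>
      refine ⟨1, one_pos, fun t ht => ?_⟩
      have hs : 0 ≤ 1 - t := sub_nonneg.2 ht.2
      have hden : 0 < σw ^ 2 + σb ^ 2 := by positivity
      refine ⟨?_, ?_⟩
      · rw [hF1 t ht, le_div_iff₀ hden, div_le_one hden]
        constructor <;> nlinarith [mul_nonneg (sq_nonneg σb) hs, mul_nonneg (sq_nonneg σw) hs]
      · have h0 : F 1 t - 1 + D 1 * (1 - t) = 0 := by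
          rw [hF1 t ht, hD1]
          field_simp
          ring
        rw [h0, abs_zero]
        positivity
    | succ n hn ih =>
      obtain ⟨C, hC, ih⟩ := ih
      have hQn := hQpos n hn
      have hden : 0 < Q n * σw ^ 2 + 2 * σb ^ 2 := by positivity
      obtain ⟨a, ha⟩ : ∃ a, a = Q n * σw ^ 2 / (Q n * σw ^ 2 + 2 * σb ^ 2) := ⟨_, rfl⟩
      have ha0 : 0 ≤ a := by rw [ha]; positivity
      have ha1 : a ≤ 1 := by
        rw [ha, div_le_one hden]
        linarith [sq_nonneg σb]
      have hD : D (n + 1) = a * D n := by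
        rw [hDl (n + 1) (by omega), Nat.add_sub_cancel, ha]
      refine ⟨C + 1, by positivity, fun t ht => ?_⟩
      obtain ⟨⟨htF, hF1'⟩, hb⟩ := ih t ht
      have hu : F n t ∈ Set.Icc (-1 : ℝ) 1 := ⟨ht.1.trans htF, hF1'⟩
      have hF : F (n + 1) t = 1 - a * (1 - Psi (F n t)) := by
        rw [hFl (n + 1) (by omega) t ht, Nat.add_sub_cancel, ha]
        field_simp
        ring
      have hle := self_le_Psi hu
      have hle1 := Psi_le_one_s9 hu
      refine ⟨⟨?_, ?_⟩, ?_⟩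
      · nlinarith [mul_nonneg (sub_nonneg.2 ha1) (sub_nonneg.2 hle1)]
      · linarith [mul_nonneg ha0 (sub_nonneg.2 hle1)]
      · have hpow : (1 - F n t) ^ ((3 : ℝ) / 2) ≤ (1 - t) ^ ((3 : ℝ) / 2) :=
          Real.rpow_le_rpow (by linarith) (by linarith) (by norm_num)
        calc |F (n + 1) t - 1 + D (n + 1) * (1 - t)|
            = a * |(Psi (F n t) - F n t) + (F n t - 1 + D n * (1 - t))| := by
              have hmul (x : ℝ) : a * |x| = |a * x| := by rw [abs_mul, abs_of_nonneg ha0]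
              rw [hmul, hF, hD]
              ring_nf
          _ ≤ |(Psi (F n t) - F n t) + (F n t - 1 + D n * (1 - t))| :=
              mul_le_of_le_one_left (abs_nonneg _) ha1
          _ ≤ |Psi (F n t) - F n t| + |F n t - 1 + D n * (1 - t)| := abs_add_le _ _
          _ ≤ (1 - t) ^ ((3 : ℝ) / 2) + C * (1 - t) ^ ((3 : ℝ) / 2) := by
              refine add_le_add ?_ hb
              rw [abs_of_nonneg (sub_nonneg.2 hle)]
              exact (Psi_sub_self_le_rpow hu).trans hpow
          _ = (C + 1) * (1 - t) ^ ((3 : ℝ) / 2) := by ring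
  intro l hl
  obtain ⟨C, hC, h⟩ := key l hl
  refine ⟨⟨C, hC, 2, two_pos, fun t ht => (h t ⟨by linarith [ht.1], ht.2⟩).2⟩, ?_⟩
  exact hasDerivWithinAt_of_abs_le_rpow fun t ht => (h t ht).2
end

section
/- For every ρ ∈ [-1,1], (1/(2π)) · ∫_{ℝ²} max(0, z) · max(0, ρ·z + √(1-ρ²)·w) · e^{-(z²+w²)/2} dz dw = (√(1-ρ²) + (π - arccos ρ)·ρ)/(2π). -/
open Real MeasureTheory

theorem integral_Ioi_pow_three_mul_exp_neg_sq_div_two :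
    ∫ r in Set.Ioi (0 : ℝ), r ^ 3 * Real.exp (-r ^ 2 / 2) = 2 := by
  have h := integral_rpow_mul_exp_neg_mul_rpow (p := 2) (q := 3) (b := 1 / 2)
    (by norm_num) (by norm_num) (by norm_num)
  have hG : Real.Gamma ((3 + 1) / 2) = 1 := by
    norm_num [Real.Gamma_two]
  have hb : ((1 : ℝ) / 2) ^ (-((3 : ℝ) + 1) / 2) = 4 := by
    rw [show (-((3 : ℝ) + 1) / 2) = ((-2 : ℤ) : ℝ) by norm_num, Real.rpow_intCast]
    norm_num
  rw [hG, hb] at h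
  calc _ = ∫ r in Set.Ioi (0 : ℝ), r ^ (3 : ℝ) * Real.exp (-(1 / 2) * r ^ (2 : ℝ)) := by
        congr 1 with r
        norm_cast
        ring_nf
    _ = 2 := by rw [h]; norm_num

/-- The angular part of the Gaussian expectation of two rectified variables at angle `α`. -/
theorem integral_max_cos_mul_max_cos_sub {α : ℝ} (h0 : 0 ≤ α) (hπ : α ≤ π) :
    ∫ θ in -π..π, max 0 (cos θ) * max 0 (cos (θ - α)) = (sin α + (π - α) * cos α) / 2 := by
  have hpi := Real.pi_pos
  have hint : ∀ a b : ℝ, IntervalIntegrable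
      (fun θ => max 0 (cos θ) * max 0 (cos (θ - α))) volume a b := fun a b =>
    Continuous.intervalIntegrable (by fun_prop) a b
  have hzero : ∀ a b : ℝ, a ≤ b →
      (∀ θ ∈ Set.Icc a b, cos θ ≤ 0 ∨ cos (θ - α) ≤ 0) →
      ∫ θ in a..b, max 0 (cos θ) * max 0 (cos (θ - α)) = 0 := by
    intro a b hab h
    rw [← intervalIntegral.integral_zero (a := a) (b := b) (μ := volume)]
    refine intervalIntegral.integral_congr fun θ hθ => ?_
    rw [Set.uIcc_of_le hab] at hθ
    rcases h θ hθ with h | h <;> simp [max_eq_left h]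
  have h₁ : ∫ θ in -π..-(π / 2), max 0 (cos θ) * max 0 (cos (θ - α)) = 0 := by
    refine hzero _ _ (by linarith) fun θ hθ => Or.inl ?_
    rw [← cos_neg]
    exact cos_nonpos_of_pi_div_two_le_of_le (by linarith [hθ.2]) (by linarith [hθ.1])
  have h₂ : ∫ θ in -(π / 2)..α - π / 2, max 0 (cos θ) * max 0 (cos (θ - α)) = 0 := by
    refine hzero _ _ (by linarith) fun θ hθ => Or.inr ?_
    rw [← cos_neg]
    exact cos_nonpos_of_pi_div_two_le_of_le (by linarith [hθ.2]) (by linarith [hθ.1])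
  have h₃ : ∫ θ in π / 2..π, max 0 (cos θ) * max 0 (cos (θ - α)) = 0 := by
    refine hzero _ _ (by linarith) fun θ hθ => Or.inl ?_
    exact cos_nonpos_of_pi_div_two_le_of_le (by linarith [hθ.1]) (by linarith [hθ.2])
  have h₄ : ∫ θ in α - π / 2..π / 2, max 0 (cos θ) * max 0 (cos (θ - α))
      = (sin α + (π - α) * cos α) / 2 := by
    have hcongr : ∫ θ in α - π / 2..π / 2, max 0 (cos θ) * max 0 (cos (θ - α))
        = ∫ θ in α - π / 2..π / 2, cos θ * cos (θ - α) := by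
      refine intervalIntegral.integral_congr fun θ hθ => ?_
      rw [Set.uIcc_of_le (by linarith)] at hθ
      have hc : 0 ≤ cos θ :=
        cos_nonneg_of_neg_pi_div_two_le_of_le (by linarith [hθ.1]) hθ.2
      have hc' : 0 ≤ cos (θ - α) :=
        cos_nonneg_of_neg_pi_div_two_le_of_le (by linarith [hθ.1]) (by linarith [hθ.2])
      simp only [max_eq_right hc, max_eq_right hc']
    have hderiv : ∀ θ ∈ Set.uIcc (α - π / 2) (π / 2),
        HasDerivAt (fun θ => θ * (cos α / 2) + sin (2 * θ - α) / 4)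
          (cos θ * cos (θ - α)) θ := by
      intro θ _
      have h := ((hasDerivAt_id θ).mul_const (cos α / 2)).add
        ((((hasDerivAt_id θ).const_mul 2).sub_const α).sin.div_const 4)
      refine h.congr_deriv ?_
      have e₁ : cos (2 * θ - α) = cos θ * cos (θ - α) - sin θ * sin (θ - α) := by
        rw [← cos_add]; ring_nf
      have e₂ : cos α = cos θ * cos (θ - α) + sin θ * sin (θ - α) := by
        rw [← cos_sub]; ring_nf
      simp only [id]
      rw [e₁, e₂]
      ring
    rw [hcongr, intervalIntegral.integral_eq_sub_of_hasDerivAt hderiv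
      (Continuous.intervalIntegrable (by fun_prop) _ _)]
    rw [show 2 * (π / 2) - α = π - α by ring, show 2 * (α - π / 2) - α = α - π by ring,
      sin_pi_sub, sin_sub_pi]
    ring
  rw [← intervalIntegral.integral_add_adjacent_intervals (hint _ (-(π / 2))) (hint _ _),
    ← intervalIntegral.integral_add_adjacent_intervals (hint (-(π / 2)) (α - π / 2)) (hint _ _),
    ← intervalIntegral.integral_add_adjacent_intervals (hint (α - π / 2) (π / 2)) (hint _ _),
    h₁, h₂, h₃, h₄]
  ring

/-- The arc-cosine kernel identity of Cho and Saul: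
`E[max(0,Z)·max(0,Y)] = (√(1-ρ²) + (π - arccos ρ)·ρ)/(2π)` for jointly Gaussian standard
random variables with correlation `ρ`, realized as `Y = ρZ + √(1-ρ²)W`. -/
theorem arccos_kernel_identity :
    ∀ ρ ∈ Set.Icc (-1 : ℝ) 1,
      (1 / (2 * Real.pi)) *
          ∫ p : ℝ × ℝ, max 0 p.1 * max 0 (ρ * p.1 + Real.sqrt (1 - ρ ^ 2) * p.2) *
            Real.exp (-(p.1 ^ 2 + p.2 ^ 2) / 2)
        = (Real.sqrt (1 - ρ ^ 2) + (Real.pi - Real.arccos ρ) * ρ) / (2 * Real.pi) := by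
  rintro ρ ⟨hρ₁, hρ₂⟩
  have hcos : cos (arccos ρ) = ρ := cos_arccos hρ₁ hρ₂
  have hsin : sin (arccos ρ) = √(1 - ρ ^ 2) := sin_arccos ρ
  have hpolar : ∀ p ∈ polarCoord.target,
      p.1 • (fun p : ℝ × ℝ => max 0 p.1 * max 0 (ρ * p.1 + √(1 - ρ ^ 2) * p.2) *
        exp (-(p.1 ^ 2 + p.2 ^ 2) / 2)) (polarCoord.symm p)
      = (p.1 ^ 3 * exp (-p.1 ^ 2 / 2)) *
        (max 0 (cos p.2) * max 0 (cos (p.2 - arccos ρ))) := by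
    rintro ⟨r, θ⟩ hp
    have hr : 0 ≤ r := (Set.mem_Ioi.mp hp.1).le
    have hmax : ∀ x : ℝ, max 0 (r * x) = r * max 0 x := fun x => by
      rw [mul_max_of_nonneg _ _ hr, mul_zero]
    have hlin : ρ * (r * cos θ) + √(1 - ρ ^ 2) * (r * sin θ) = r * cos (θ - arccos ρ) := by
      rw [cos_sub, hcos, hsin]; ring
    have hsq : (r * cos θ) ^ 2 + (r * sin θ) ^ 2 = r ^ 2 := by
      linear_combination r ^ 2 * sin_sq_add_cos_sq θ
    simp only [polarCoord_symm_apply, smul_eq_mul, hlin, hsq, hmax]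
    ring
  rw [← integral_comp_polarCoord_symm,
    setIntegral_congr_fun polarCoord.open_target.measurableSet hpolar,
    polarCoord_target, Measure.volume_eq_prod,
    setIntegral_prod_mul (fun r : ℝ => r ^ 3 * exp (-r ^ 2 / 2))
      (fun θ : ℝ => max 0 (cos θ) * max 0 (cos (θ - arccos ρ))),
    integral_Ioi_pow_three_mul_exp_neg_sq_div_two, ← integral_Ioc_eq_integral_Ioo,
    ← intervalIntegral.integral_of_le (by linarith [pi_pos]),
    integral_max_cos_mul_max_cos_sub (arccos_nonneg ρ) (arccos_le_pi ρ), hcos, hsin]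
  ring
end

section
/- Let φ be a random variable on a probability space taking values in the space C([0,1], ℝ) of continuous real-valued functions on [0,1], such that φ(0) ≠ 0 almost surely. For f ∈ C([0,1], ℝ) define T(f) = min( inf{ t ∈ [0,1] : f(t) = 0 }, 1 ), with the convention that the infimum of the empty set is 1. Then t₀ := E[T(φ)] > 0, and for every n ≥ 1, E[ min( { i ∈ {1,…,n} : φ(0)·φ(i/n) < 0 } ∪ {n} ) ] ≥ n·t₀. -/
open Real MeasureTheory Classical

/-- The first zero of a continuous function on `[0,1]` (capped at `1`,
with the convention that the infimum of the empty set is `1`). -/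
noncomputable def firstZero (f : C(unitInterval, ℝ)) : ℝ :=
  if {t : unitInterval | f t = 0}.Nonempty then
    sInf ((fun t : unitInterval => (t : ℝ)) '' {t : unitInterval | f t = 0})
  else 1

theorem firstZero_le_of_eq_zero {f : C(unitInterval, ℝ)} {t : unitInterval} (ht : f t = 0) :
    firstZero f ≤ t := by
  have hne : {t : unitInterval | f t = 0}.Nonempty := ⟨t, ht⟩
  rw [firstZero, if_pos hne]
  refine csInf_le ⟨0, ?_⟩ ⟨t, ht, rfl⟩
  rintro _ ⟨s, -, rfl⟩
  exact s.2.1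

theorem firstZero_eq_one_or_exists (f : C(unitInterval, ℝ)) :
    firstZero f = 1 ∨ ∃ t : unitInterval, f t = 0 ∧ firstZero f = t := by
  by_cases hne : {t : unitInterval | f t = 0}.Nonempty
  · right
    have hc : IsCompact {t : unitInterval | f t = 0} :=
      (isClosed_eq f.continuous continuous_const).isCompact
    obtain ⟨t, ht, h⟩ := (hc.image continuous_subtype_val).sInf_mem (hne.image _)
    refine ⟨t, ht, ?_⟩
    rw [firstZero, if_pos hne]
    exact h.symm
  · left
    rw [firstZero, if_neg hne]

theorem firstZero_le_one (f : C(unitInterval, ℝ)) : firstZero f ≤ 1 := by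
  obtain h | ⟨t, -, h⟩ := firstZero_eq_one_or_exists f
  · exact h.le
  · exact h.le.trans t.2.2

theorem firstZero_nonneg (f : C(unitInterval, ℝ)) : 0 ≤ firstZero f := by
  obtain h | ⟨t, -, h⟩ := firstZero_eq_one_or_exists f
  · exact h ▸ zero_le_one
  · exact h ▸ t.2.1

theorem firstZero_pos {f : C(unitInterval, ℝ)} (hf : f 0 ≠ 0) : 0 < firstZero f := by
  obtain h | ⟨t, ht, h⟩ := firstZero_eq_one_or_exists f
  · exact h ▸ zero_lt_one
  · rw [h]
    refine unitInterval.pos_iff_ne_zero.2 ?_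
    rintro rfl
    exact hf ht

theorem lt_firstZero_iff {f : C(unitInterval, ℝ)} {a : ℝ} :
    a < firstZero f ↔ a < 1 ∧ ∀ t : unitInterval, (t : ℝ) ≤ a → f t ≠ 0 := by
  constructor
  · intro h
    exact ⟨h.trans_le (firstZero_le_one f), fun t hta ht =>
      (h.trans_le (firstZero_le_of_eq_zero ht)).not_ge hta⟩
  · rintro ⟨h1, h⟩
    obtain h' | ⟨t, ht, h'⟩ := firstZero_eq_one_or_exists f
    · rwa [h']
    · rw [h']
      by_contra! hta
      exact h t hta ht

theorem lowerSemicontinuous_firstZero : LowerSemicontinuous firstZero := by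
  rw [lowerSemicontinuous_iff_isOpen_preimage]
  intro a
  by_cases ha : a < 1
  · have hK : IsCompact {t : unitInterval | (t : ℝ) ≤ a} :=
      (isClosed_le continuous_subtype_val continuous_const).isCompact
    convert ContinuousMap.isOpen_setOfPred_mapsTo hK (isOpen_compl_singleton (x := (0 : ℝ))) using 1
    ext f
    simp [lt_firstZero_iff, ha, Set.MapsTo]
  · convert isOpen_empty
    ext f
    simp [lt_firstZero_iff, ha]

theorem firstZero_le_of_mul_neg {f : C(unitInterval, ℝ)} {t : unitInterval}
    (h : f 0 * f t < 0) : firstZero f ≤ t := by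
  have hmem : (0 : ℝ) ∈ Set.uIcc (f 0) (f t) := by
    rw [Set.mem_uIcc]
    obtain ⟨h1, h2⟩ | ⟨h1, h2⟩ := mul_neg_iff.1 h
    · exact Or.inr ⟨h2.le, h1.le⟩
    · exact Or.inl ⟨h1.le, h2.le⟩
  obtain ⟨s, hs, hfs⟩ := intermediate_value_uIcc f.continuous.continuousOn hmem
  rw [Set.uIcc_of_le unitInterval.nonneg'] at hs
  exact (firstZero_le_of_eq_zero hfs).trans hs.2

theorem mul_firstZero_le_sInf (f : C(unitInterval, ℝ)) (n : ℕ) :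
    (n : ℝ) * firstZero f ≤ ((sInf ({i : ℕ | 1 ≤ i ∧ i ≤ n ∧
      f 0 * f (Set.projIcc 0 1 zero_le_one ((i : ℝ) / n)) < 0} ∪ {n}) : ℕ) : ℝ) := by
  suffices H : ∀ i ∈ ({i : ℕ | 1 ≤ i ∧ i ≤ n ∧
      f 0 * f (Set.projIcc 0 1 zero_le_one ((i : ℝ) / n)) < 0} ∪ {n} : Set ℕ),
      (n : ℝ) * firstZero f ≤ i from H _ (Nat.sInf_mem ⟨n, Or.inr rfl⟩)
  rintro i (⟨h1, hn, h⟩ | h)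
  · have hn0 : (0 : ℝ) < n := by exact_mod_cast h1.trans hn
    have hi : (i : ℝ) / n ∈ Set.Icc (0 : ℝ) 1 :=
      ⟨by positivity, (div_le_one hn0).2 (by exact_mod_cast hn)⟩
    rw [Set.projIcc_of_mem _ hi] at h
    have := firstZero_le_of_mul_neg h
    rwa [le_div_iff₀' hn0] at this
  · rw [Set.mem_singleton_iff.1 h]
    exact mul_le_of_le_one_right n.cast_nonneg (firstZero_le_one f)

theorem measurable_sInf_nat {Ω : Type*} [MeasurableSpace Ω] {S : Ω → Set ℕ}
    (hne : ∀ ω, (S ω).Nonempty) (hS : ∀ k, MeasurableSet {ω | k ∈ S ω}) :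
    Measurable fun ω => sInf (S ω) := by
  have h := measurable_find (p := fun ω k => k ∈ S ω) hne hS
  convert h using 2 with ω
  rw [Nat.sInf_def (hne ω)]

/-- For a random continuous function `φ` on `[0,1]` with `φ(0) ≠ 0` almost surely, the
expected first zero `t₀ = E[T(φ)]` is positive, and the expected minimal index
`i ∈ {1,…,n}` with `φ(0)·φ(i/n) < 0` (capped at `n`) is at least `n·t₀`. -/
theorem random_bit_flips_lower_bound {Ω : Type*} [MeasurableSpace Ω]
    (μ : Measure Ω) [IsProbabilityMeasure μ]
    [MeasurableSpace C(unitInterval, ℝ)] [BorelSpace C(unitInterval, ℝ)]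
    (φ : Ω → C(unitInterval, ℝ)) (hφ : Measurable φ)
    (h0 : ∀ᵐ ω ∂μ, φ ω 0 ≠ 0) :
    0 < ∫ ω, firstZero (φ ω) ∂μ ∧
    ∀ n : ℕ, 1 ≤ n →
      (n : ℝ) * ∫ ω, firstZero (φ ω) ∂μ ≤
        ∫ ω, ((sInf ({i : ℕ | 1 ≤ i ∧ i ≤ n ∧
            φ ω 0 * φ ω (Set.projIcc 0 1 zero_le_one ((i : ℝ) / n)) < 0} ∪ {n}) : ℕ) : ℝ) ∂μ := by
  have hint : Integrable (fun ω => firstZero (φ ω)) μ := by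
    refine Integrable.of_bound
      (lowerSemicontinuous_firstZero.measurable.comp hφ).aestronglyMeasurable 1
      (Filter.Eventually.of_forall fun ω => ?_)
    rw [Real.norm_of_nonneg (firstZero_nonneg _)]
    exact firstZero_le_one _
  refine ⟨?_, fun n _ => ?_⟩
  · rw [integral_pos_iff_support_of_nonneg (fun ω => firstZero_nonneg _) hint]
    have hsupp : (Function.support fun ω => firstZero (φ ω)) ∈ ae μ :=
      h0.mono fun ω hω => (firstZero_pos hω).ne'
    rw [measure_congr (Filter.eventuallyEq_univ.2 hsupp), measure_univ]
    exact zero_lt_one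
  · rw [← integral_const_mul]
    have heval (t : unitInterval) : Measurable fun ω => φ ω t :=
      (continuous_eval_const t).measurable.comp hφ
    refine integral_mono (hint.const_mul _) (Integrable.of_bound (C := n) ?_ ?_)
      fun ω => mul_firstZero_le_sInf (φ ω) n
    · refine (measurable_from_top.comp
        (measurable_sInf_nat (fun ω => ⟨n, Or.inr rfl⟩) fun k => ?_)).aestronglyMeasurable
      have hneg := measurableSet_lt ((heval 0).mul
        (heval (Set.projIcc 0 1 zero_le_one ((k : ℝ) / n)))) (measurable_const (a := (0 : ℝ)))
      exact ((MeasurableSet.const _).inter ((MeasurableSet.const _).inter hneg)).union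
        (MeasurableSet.const _)
    · refine Filter.Eventually.of_forall fun ω => ?_
      rw [Real.norm_of_nonneg (Nat.cast_nonneg _)]
      exact_mod_cast Nat.sInf_le (Or.inr rfl)
end

section
/- Let σ_w > 0 and σ_b ≥ 0. Define Q_1 = σ_w² + σ_b² and Q_l = σ_w²·Q_{l-1}/2 + σ_b² for l ≥ 2. Define F_1(t) = (σ_w²·t + σ_b²)/(σ_w² + σ_b²) and, for l ≥ 2 and t ∈ [-1,1], F_l(t) = (Q_{l-1}·σ_w²·Ψ(F_{l-1}(t)) + 2σ_b²)/(Q_{l-1}·σ_w² + 2σ_b²), where Ψ(t) = (√(1-t²) + (π - arccos t)·t)/π. Then for every l ≥ 1, F_l is monotone nondecreasing on [-1,1]. -/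
open Real

lemma antitoneOn_sin_add_pi_sub_mul_cos :
    AntitoneOn (fun θ : ℝ => Real.sin θ + (Real.pi - θ) * Real.cos θ) (Set.Icc 0 Real.pi) := by
  have hd (θ : ℝ) : HasDerivAt (fun θ : ℝ => Real.sin θ + (Real.pi - θ) * Real.cos θ)
      (-((Real.pi - θ) * Real.sin θ)) θ := by
    refine ((Real.hasDerivAt_sin θ).add
      (((hasDerivAt_id θ).const_sub Real.pi).mul (Real.hasDerivAt_cos θ))).congr_deriv ?_
    simp only [id_eq]
    ring
  refine antitoneOn_of_deriv_nonpos (convex_Icc _ _)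
    (fun θ _ => (hd θ).continuousAt.continuousWithinAt)
    (fun θ _ => (hd θ).differentiableAt.differentiableWithinAt) fun θ hθ => ?_
  obtain ⟨h0, h1⟩ := interior_subset hθ
  rw [(hd θ).deriv]
  exact neg_nonpos.2 (mul_nonneg (sub_nonneg.2 h1) (Real.sin_nonneg_of_nonneg_of_le_pi h0 h1))

lemma Psi_eq_sin_arccos {t : ℝ} (ht : t ∈ Set.Icc (-1 : ℝ) 1) :
    Psi t = (Real.sin (Real.arccos t) +
      (Real.pi - Real.arccos t) * Real.cos (Real.arccos t)) / Real.pi := by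
  rw [Psi, Real.sin_arccos, Real.cos_arccos ht.1 ht.2]

lemma monotoneOn_Psi : MonotoneOn Psi (Set.Icc (-1 : ℝ) 1) := by
  intro s hs t ht hst
  rw [Psi_eq_sin_arccos hs, Psi_eq_sin_arccos ht]
  exact div_le_div_of_nonneg_right
    (antitoneOn_sin_add_pi_sub_mul_cos ⟨Real.arccos_nonneg t, Real.arccos_le_pi t⟩
      ⟨Real.arccos_nonneg s, Real.arccos_le_pi s⟩ (Real.arccos_le_arccos hst))
    Real.pi_pos.le

lemma Psi_mem_Icc {t : ℝ} (ht : t ∈ Set.Icc (-1 : ℝ) 1) : Psi t ∈ Set.Icc (0 : ℝ) 1 := by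
  have h0 : Psi (-1) = 0 := by simp [Psi]
  have h1 : Psi 1 = 1 := by simp [Psi, Real.pi_ne_zero]
  constructor
  · exact h0 ▸ monotoneOn_Psi (by norm_num) ht ht.1
  · exact h1 ▸ monotoneOn_Psi ht (by norm_num) ht.2

/-- The layerwise correlation functions `F_l` of a random deep neural network with ReLU
activation are monotone nondecreasing on `[-1,1]`. -/
theorem correlation_function_monotone (σw σb : ℝ) (hw : 0 < σw) (hb : 0 ≤ σb)
    (Q : ℕ → ℝ) (hQ1 : Q 1 = σw ^ 2 + σb ^ 2)
    (hQl : ∀ l, 2 ≤ l → Q l = σw ^ 2 * Q (l - 1) / 2 + σb ^ 2)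
    (F : ℕ → ℝ → ℝ)
    (hF1 : ∀ t ∈ Set.Icc (-1 : ℝ) 1, F 1 t = (σw ^ 2 * t + σb ^ 2) / (σw ^ 2 + σb ^ 2))
    (hFl : ∀ l, 2 ≤ l → ∀ t ∈ Set.Icc (-1 : ℝ) 1,
      F l t = (Q (l - 1) * σw ^ 2 * Psi (F (l - 1) t) + 2 * σb ^ 2) /
        (Q (l - 1) * σw ^ 2 + 2 * σb ^ 2)) :
    ∀ l, 1 ≤ l → MonotoneOn (F l) (Set.Icc (-1 : ℝ) 1) := by
  have hw2 : 0 < σw ^ 2 := by positivity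
  have hb2 : 0 ≤ σb ^ 2 := sq_nonneg σb
  have hQ : ∀ l, 1 ≤ l → 0 < Q l := by
    intro l hl
    induction l, hl using Nat.le_induction with
    | base => rw [hQ1]; positivity
    | succ n hn ih =>
      rw [hQl (n + 1) (by omega), Nat.add_sub_cancel]
      positivity
  suffices h : ∀ l, 1 ≤ l → MonotoneOn (F l) (Set.Icc (-1 : ℝ) 1) ∧
      Set.MapsTo (F l) (Set.Icc (-1 : ℝ) 1) (Set.Icc (-1 : ℝ) 1) from fun l hl => (h l hl).1
  intro l hl
  induction l, hl using Nat.le_induction with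
  | base =>
    have hD : 0 < σw ^ 2 + σb ^ 2 := by positivity
    refine ⟨fun s hs t ht hst => ?_, fun t ht => ?_⟩
    · rw [hF1 s hs, hF1 t ht]
      gcongr
    · rw [hF1 t ht, Set.mem_Icc, le_div_iff₀ hD, div_le_one hD]
      constructor <;> nlinarith [ht.1, ht.2]
  | succ n hn ih =>
    obtain ⟨hmono, hmaps⟩ := ih
    have hA : 0 < Q n * σw ^ 2 := mul_pos (hQ n hn) hw2
    have hD : 0 < Q n * σw ^ 2 + 2 * σb ^ 2 := by positivity
    have hF : ∀ t ∈ Set.Icc (-1 : ℝ) 1, F (n + 1) t =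
        (Q n * σw ^ 2 * Psi (F n t) + 2 * σb ^ 2) / (Q n * σw ^ 2 + 2 * σb ^ 2) :=
      hFl (n + 1) (by omega)
    refine ⟨fun s hs t ht hst => ?_, fun t ht => ?_⟩
    · have hPsi := monotoneOn_Psi (hmaps hs) (hmaps ht) (hmono hs ht hst)
      rw [hF s hs, hF t ht]
      gcongr
    · obtain ⟨h0, h1⟩ := Psi_mem_Icc (hmaps ht)
      rw [hF t ht, Set.mem_Icc, le_div_iff₀ hD, div_le_one hD]
      constructor <;> nlinarith [mul_nonneg hA.le h0, mul_le_mul_of_nonneg_left h1 hA.le]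
end
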